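/- Let K ≥ 1, and for each k ∈ {1,…,K} let V^{(k)} ∈ ℝ^{C×D} have no zero entries and pairwise distinct entries in its d-th column, and let a^{(k)} ∈ ℝ^C. Let x' ∈ ℝ^D with x'_d ≠ 0, let p̄_c(x) = (1/K) Σ_{k=1}^{K} softmax(V^{(k)} x + a^{(k)})_c, and define the predictive entropy E(x) = −Σ_{c=1}^{C} p̄_c(x) log p̄_c(x). Then the Euclidean norm of the gradient of E evaluated at the scaled point x_α tends to 0 as α → ∞. -/

import Mathlib

/-- The softmax function on `ℝ^C`. -/
noncomputable def softmax {C : ℕ} (z : Fin C → ℝ) : Fin C → ℝ :=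
  fun c => Real.exp (z c) / ∑ c', Real.exp (z c')

/-- The point `x'` scaled by `α` in coordinate `d` (all other coordinates unchanged). -/
def scaled {D : ℕ} (x' : Fin D → ℝ) (d : Fin D) (α : ℝ) : Fin D → ℝ :=
  Function.update x' d (α * x' d)

/-- The averaged predictive distribution of `K` softmax-affine model instances. -/
noncomputable def avgPred {D C K : ℕ} (V : Fin K → Matrix (Fin C) (Fin D) ℝ)
    (a : Fin K → Fin C → ℝ) (x : Fin D → ℝ) (c : Fin C) : ℝ :=
  (1 / (K : ℝ)) * ∑ k : Fin K, softmax ((V k).mulVec x + a k) c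

open Filter Topology

lemma softmax_denom_pos {C : ℕ} (z : Fin C → ℝ) (c : Fin C) : 0 < ∑ c', Real.exp (z c') :=
  Finset.sum_pos (fun _ _ => Real.exp_pos _) ⟨c, Finset.mem_univ c⟩

lemma softmax_pos {C : ℕ} (z : Fin C → ℝ) (c : Fin C) : 0 < softmax z c :=
  div_pos (Real.exp_pos _) (softmax_denom_pos z c)

lemma sum_softmax {C : ℕ} (z : Fin C → ℝ) (c : Fin C) : ∑ c', softmax z c' = 1 := by
  unfold softmax
  rw [← Finset.sum_div, div_self (softmax_denom_pos z c).ne']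

lemma softmax_add_softmax_le_one {C : ℕ} (z : Fin C → ℝ) {c c' : Fin C} (h : c ≠ c') :
    softmax z c + softmax z c' ≤ 1 := by
  rw [← sum_softmax z c, ← Finset.sum_pair h]
  exact Finset.sum_le_sum_of_subset_of_nonneg (Finset.subset_univ _)
    fun i _ _ => (softmax_pos z i).le

lemma softmax_le_one {C : ℕ} (z : Fin C → ℝ) (c : Fin C) : softmax z c ≤ 1 := by
  rw [← sum_softmax z c]
  exact Finset.single_le_sum (fun i _ => (softmax_pos z i).le) (Finset.mem_univ c)

lemma softmax_eq_inv_sum_exp_sub {C : ℕ} (z : Fin C → ℝ) (c : Fin C) :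
    softmax z c = (∑ c', Real.exp (z c' - z c))⁻¹ := by
  simp only [Real.exp_sub, ← Finset.sum_div, inv_div, softmax]

/-- The derivative of `softmax ∘ z` in terms of the derivatives of the logits `z`. -/
lemma hasFDerivAt_softmax {E : Type*} [NormedAddCommGroup E] [NormedSpace ℝ E] {C : ℕ}
    {z : E → Fin C → ℝ} {L : Fin C → E →L[ℝ] ℝ} {x : E}
    (hz : ∀ c, HasFDerivAt (fun y => z y c) (L c) x) (c : Fin C) :
    HasFDerivAt (fun y => softmax (z y) c)
      (softmax (z x) c • ∑ c', softmax (z x) c' • (L c - L c')) x := by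
  have hsum : HasFDerivAt (fun y => ∑ c', Real.exp (z y c' - z y c))
      (∑ c', Real.exp (z x c' - z x c) • (L c' - L c)) x :=
    HasFDerivAt.fun_sum fun c' _ => ((hz c').sub (hz c)).exp
  have hpos : 0 < ∑ c', Real.exp (z x c' - z x c) :=
    softmax_denom_pos (fun c' => z x c' - z x c) c
  have h := (hasDerivAt_inv hpos.ne').comp_hasFDerivAt x hsum
  simp only [Function.comp_def, ← softmax_eq_inv_sum_exp_sub] at h
  refine h.congr_fderiv ?_
  have hs : ∀ c', softmax (z x) c' = softmax (z x) c * Real.exp (z x c' - z x c) := by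
    intro c'
    rw [Real.exp_sub]
    unfold softmax
    field_simp
  rw [Finset.smul_sum, Finset.smul_sum]
  refine Finset.sum_congr rfl fun c' _ => ?_
  rw [hs c', ← inv_pow, ← softmax_eq_inv_sum_exp_sub, ← neg_sub (L c) (L c')]
  module

lemma norm_softmax_fderiv_le {E : Type*} [NormedAddCommGroup E] [NormedSpace ℝ E] {C : ℕ}
    (z : Fin C → ℝ) (L : Fin C → E →L[ℝ] ℝ) (c : Fin C) :
    ‖softmax z c • ∑ c', softmax z c' • (L c - L c')‖ ≤
      softmax z c * (1 - softmax z c) * ∑ c', ‖L c - L c'‖ := by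
  rw [norm_smul, Real.norm_of_nonneg (softmax_pos z c).le, mul_assoc]
  refine mul_le_mul_of_nonneg_left ?_ (softmax_pos z c).le
  rw [Finset.mul_sum]
  refine norm_sum_le_of_le _ fun c' _ => ?_
  rw [norm_smul, Real.norm_of_nonneg (softmax_pos z c').le]
  rcases eq_or_ne c c' with rfl | h
  · simp
  · exact mul_le_mul_of_nonneg_right (by linarith [softmax_add_softmax_le_one z h])
      (norm_nonneg _)

/-- Along a ray with pairwise distinct slopes, each softmax component tends to `0` or `1`. -/
lemma tendsto_softmax_affine {C : ℕ} (u b : Fin C → ℝ) (hu : Function.Injective u) (c : Fin C) :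
    Tendsto (fun α : ℝ => softmax (fun c' => α * u c' + b c') c) atTop (𝓝 0) ∨
      Tendsto (fun α : ℝ => softmax (fun c' => α * u c' + b c') c) atTop (𝓝 1) := by
  have hsub : ∀ (c' : Fin C) (α : ℝ),
      (α * u c' + b c') - (α * u c + b c) = α * (u c' - u c) + (b c' - b c) := by
    intros; ring
  simp only [softmax_eq_inv_sum_exp_sub, hsub]
  by_cases h : ∃ c', u c < u c'
  · obtain ⟨c', hc'⟩ := h
    left
    refine Tendsto.inv_tendsto_atTop ?_
    refine tendsto_atTop_mono (fun α => Finset.single_le_sum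
      (f := fun i => Real.exp (α * (u i - u c) + (b i - b c)))
      (fun i _ => (Real.exp_pos _).le) (Finset.mem_univ c')) ?_
    exact Real.tendsto_exp_atTop.comp (tendsto_atTop_add_const_right _ _
      (tendsto_id.atTop_mul_const (sub_pos.2 hc')))
  · push Not at h
    right
    have hlim : Tendsto (fun α : ℝ => ∑ c', Real.exp (α * (u c' - u c) + (b c' - b c))) atTop
        (𝓝 (∑ c', if c' = c then 1 else 0)) := by
      refine tendsto_finsetSum _ fun c' _ => ?_
      rcases eq_or_ne c' c with rfl | hne
      · simp
      · rw [if_neg hne]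
        have hlt : u c' - u c < 0 := sub_neg.2 ((h c').lt_of_ne (hu.ne hne))
        exact Real.tendsto_exp_atBot.comp (tendsto_atBot_add_const_right _ _
          (tendsto_id.atTop_mul_const_of_neg hlt))
    simpa using hlim.inv₀ (by simp)

lemma tendsto_sub_log_mul_of_tendsto_zero_or_one {ι : Type*} {l : Filter ι} {s : ι → ℝ}
    (hs : Tendsto s l (𝓝 0) ∨ Tendsto s l (𝓝 1)) (A M : ℝ) :
    Tendsto (fun i => (A - Real.log (s i)) * (s i * (1 - s i) * M)) l (𝓝 0) := by
  have hcont : Continuous fun t : ℝ => (A * t - t * Real.log t) * ((1 - t) * M) :=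
    ((continuous_const.mul continuous_id).sub Real.continuous_mul_log).mul
      ((continuous_const.sub continuous_id).mul continuous_const)
  have hg : Tendsto (fun i => (A * s i - s i * Real.log (s i)) * ((1 - s i) * M)) l (𝓝 0) := by
    rcases hs with hs | hs
    · simpa [Function.comp_def] using (hcont.tendsto 0).comp hs
    · simpa [Function.comp_def] using (hcont.tendsto 1).comp hs
  exact hg.congr fun i => by ring

lemma mulVec_scaled {D C : ℕ} (V : Matrix (Fin C) (Fin D) ℝ) (x' : Fin D → ℝ) (d : Fin D)
    (α : ℝ) (c : Fin C) :
    V.mulVec (scaled x' d α) c = α * (V c d * x' d) + V.mulVec (Function.update x' d 0) c := by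
  have h : scaled x' d α = Function.update x' d 0 + Pi.single d (α * x' d) := by
    ext j
    rcases eq_or_ne j d with rfl | hj <;> simp [scaled, *]
  rw [h, Matrix.mulVec_add, Matrix.mulVec_single]
  simp
  ring

lemma softmax_div_le_avgPred {D C K : ℕ} (V : Fin K → Matrix (Fin C) (Fin D) ℝ)
    (a : Fin K → Fin C → ℝ) (x : Fin D → ℝ) (c : Fin C) (k : Fin K) :
    softmax ((V k).mulVec x + a k) c / K ≤ avgPred V a x c := by
  rw [avgPred, div_eq_mul_one_div, mul_comm]
  exact mul_le_mul_of_nonneg_left (Finset.single_le_sum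
    (f := fun k => softmax ((V k).mulVec x + a k) c)
    (fun i _ => (softmax_pos _ c).le) (Finset.mem_univ k)) (by positivity)

lemma avgPred_le_one {D C K : ℕ} (hK : 1 ≤ K) (V : Fin K → Matrix (Fin C) (Fin D) ℝ)
    (a : Fin K → Fin C → ℝ) (x : Fin D → ℝ) (c : Fin C) : avgPred V a x c ≤ 1 := by
  have hK0 : (0 : ℝ) < K := by exact_mod_cast hK
  have h : ∑ k : Fin K, softmax ((V k).mulVec x + a k) c ≤ ∑ _k : Fin K, (1 : ℝ) :=
    Finset.sum_le_sum fun k _ => softmax_le_one _ c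
  rw [avgPred, one_div, inv_mul_le_iff₀ hK0]
  simpa using h

lemma avgPred_pos {D C K : ℕ} (hK : 1 ≤ K) (V : Fin K → Matrix (Fin C) (Fin D) ℝ)
    (a : Fin K → Fin C → ℝ) (x : Fin D → ℝ) (c : Fin C) : 0 < avgPred V a x c := by
  have hK0 : (0 : ℝ) < K := by exact_mod_cast hK
  exact (div_pos (softmax_pos _ c) hK0).trans_le (softmax_div_le_avgPred V a x c ⟨0, hK⟩)

lemma abs_log_avgPred_add_one_le {D C K : ℕ} (hK : 1 ≤ K)
    (V : Fin K → Matrix (Fin C) (Fin D) ℝ) (a : Fin K → Fin C → ℝ) (x : Fin D → ℝ) (c : Fin C)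
    (k : Fin K) :
    |Real.log (avgPred V a x c) + 1| ≤
      1 + Real.log K - Real.log (softmax ((V k).mulVec x + a k) c) := by
  have hK0 : (0 : ℝ) < K := by exact_mod_cast hK
  have hp := avgPred_pos hK V a x c
  have hs := softmax_pos ((V k).mulVec x + a k) c
  have h1 := Real.log_nonpos hp.le (avgPred_le_one hK V a x c)
  have h2 := Real.log_le_log (div_pos hs hK0) (softmax_div_le_avgPred V a x c k)
  rw [Real.log_div hs.ne' hK0.ne'] at h2
  have h3 : 0 ≤ Real.log K := Real.log_natCast_nonneg K
  have h4 := Real.log_nonpos hs.le (softmax_le_one ((V k).mulVec x + a k) c)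
  rw [abs_le]
  constructor <;> linarith

/-- The linear functional on Euclidean space given by the `c`-th row of a matrix. -/
noncomputable def rowFunctional {D C : ℕ} (V : Matrix (Fin C) (Fin D) ℝ) (c : Fin C) :
    EuclideanSpace ℝ (Fin D) →L[ℝ] ℝ :=
  ∑ j, V c j • EuclideanSpace.proj j

lemma hasFDerivAt_affine {D C : ℕ} (V : Matrix (Fin C) (Fin D) ℝ) (a : Fin C → ℝ) (c : Fin C)
    (x : EuclideanSpace ℝ (Fin D)) :
    HasFDerivAt (fun y => (V.mulVec (WithLp.equiv 2 (Fin D → ℝ) y) + a) c)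
      (rowFunctional V c) x := by
  refine ((rowFunctional V c).hasFDerivAt.add_const (a c)).congr_of_eventuallyEq
    (Eventually.of_forall fun y => ?_)
  simp [rowFunctional, Matrix.mulVec, dotProduct]

theorem norm_gradient_entropy_le {D C K : ℕ} (hK : 1 ≤ K)
    (V : Fin K → Matrix (Fin C) (Fin D) ℝ) (a : Fin K → Fin C → ℝ)
    (x : EuclideanSpace ℝ (Fin D)) :
    ‖gradient
        (fun x : EuclideanSpace ℝ (Fin D) =>
          -∑ c : Fin C,
              avgPred V a (WithLp.equiv 2 (Fin D → ℝ) x) c *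
                Real.log (avgPred V a (WithLp.equiv 2 (Fin D → ℝ) x) c)) x‖ ≤
      ∑ c, (1 / (K : ℝ)) * ∑ k,
        (1 + Real.log K -
            Real.log (softmax ((V k).mulVec (WithLp.equiv 2 (Fin D → ℝ) x) + a k) c)) *
          (softmax ((V k).mulVec (WithLp.equiv 2 (Fin D → ℝ) x) + a k) c *
            (1 - softmax ((V k).mulVec (WithLp.equiv 2 (Fin D → ℝ) x) + a k) c) *
            ∑ c', ‖rowFunctional (V k) c - rowFunctional (V k) c'‖) := by
  have hp : ∀ c, HasFDerivAt (fun y => avgPred V a (WithLp.equiv 2 (Fin D → ℝ) y) c) _ x :=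
    fun c => (HasFDerivAt.fun_sum fun k _ =>
      hasFDerivAt_softmax (fun c => hasFDerivAt_affine (V k) (a k) c x) c).const_mul (1 / (K : ℝ))
  have hE := (HasFDerivAt.fun_sum fun c (_ : c ∈ Finset.univ) =>
    (Real.hasDerivAt_mul_log (avgPred_pos hK V a (WithLp.equiv 2 (Fin D → ℝ) x) c).ne'
      ).comp_hasFDerivAt x (hp c)).fun_neg
  rw [gradient, LinearIsometryEquiv.norm_map]
  simp only [Function.comp_def] at hE
  rw [HasFDerivAt.fderiv hE, norm_neg]
  refine norm_sum_le_of_le _ fun c _ => ?_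
  rw [smul_comm, norm_smul, Real.norm_of_nonneg (by positivity)]
  refine mul_le_mul_of_nonneg_left ?_ (by positivity)
  rw [Finset.smul_sum]
  refine norm_sum_le_of_le _ fun k _ => ?_
  rw [norm_smul]
  have h := abs_log_avgPred_add_one_le hK V a (WithLp.equiv 2 (Fin D → ℝ) x) c k
  exact mul_le_mul h (norm_softmax_fderiv_le _ _ c) (norm_nonneg _) ((abs_nonneg _).trans h)

theorem stmt_7 (D C K : ℕ) (hC : 1 ≤ C) (hK : 1 ≤ K)
    (V : Fin K → Matrix (Fin C) (Fin D) ℝ) (a : Fin K → Fin C → ℝ) (d : Fin D)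
    (hV : ∀ k c d', V k c d' ≠ 0)
    (hcol : ∀ k, Function.Injective fun c => V k c d)
    (x' : Fin D → ℝ) (hx' : x' d ≠ 0) :
    Filter.Tendsto
      (fun α : ℝ =>
        ‖gradient
            (fun x : EuclideanSpace ℝ (Fin D) =>
              -∑ c : Fin C,
                  avgPred V a (WithLp.equiv 2 (Fin D → ℝ) x) c *
                    Real.log (avgPred V a (WithLp.equiv 2 (Fin D → ℝ) x) c))
            ((WithLp.equiv 2 (Fin D → ℝ)).symm (scaled x' d α))‖)
      Filter.atTop (nhds 0) := by
  refine squeeze_zero (fun _ => norm_nonneg _)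
    (fun α => norm_gradient_entropy_le hK V a _) ?_
  rw [show (0 : ℝ) = ∑ _c : Fin C, (1 / (K : ℝ)) * ∑ _k : Fin K, (0 : ℝ) by simp]
  refine tendsto_finsetSum _ fun c _ => Tendsto.const_mul _ (tendsto_finsetSum _ fun k _ => ?_)
  refine tendsto_sub_log_mul_of_tendsto_zero_or_one ?_ _ _
  have hz : ∀ α : ℝ, (V k).mulVec (scaled x' d α) + a k = fun c' =>
      α * (V k c' d * x' d) + ((V k).mulVec (Function.update x' d 0) c' + a k c') := by
    intro α
    ext c'
    rw [Pi.add_apply, mulVec_scaled, add_assoc]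
  simp only [Equiv.apply_symm_apply, hz]
  exact tendsto_softmax_affine _ _ (fun i j hij => hcol k (mul_right_cancel₀ hx' hij)) c
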